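/- arXiv:1602.00512 — 2 statements merged into one kernel-verified Lean document; each statement's English description precedes it below -/
import Mathlib

section
/- For every s ∈ (0,1) there exists a constant C(s) < ∞ such that the following holds: for every probability measure μ on a measurable space E and every jointly measurable family (X(x))_{x ∈ E} of nonnegative random variables with X(x) ≤ O_s(1) for every x ∈ E, the random variable ∫_E X dμ is almost surely finite and satisfies ∫_E X dμ ≤ O_s(C). -/
open MeasureTheory

/-- The function `y ↦ exp (y ^ s)` is convex on every half-line `[a, ∞)` with `1 ≤ s * a ^ s`. -/
lemma convexOn_exp_rpow {s a : ℝ} (hs0 : 0 < s) (ha : 0 < a) (has : 1 ≤ s * a ^ s) :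
    ConvexOn ℝ (Set.Ici a) (fun y : ℝ => Real.exp (y ^ s)) := by
  have hd : ∀ y : ℝ, 0 < y → HasDerivAt (fun y : ℝ => Real.exp (y ^ s))
      (Real.exp (y ^ s) * (s * y ^ (s - 1))) y := fun y hy =>
    (Real.hasDerivAt_rpow_const (Or.inl hy.ne')).exp
  refine MonotoneOn.convexOn_of_deriv (convex_Ici a) ?_ ?_ ?_
  · exact fun y hy => (hd y (ha.trans_le hy)).continuousAt.continuousWithinAt
  · rw [interior_Ici]
    exact fun y hy => (hd y (ha.trans hy)).differentiableAt.differentiableWithinAt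
  · rw [interior_Ici]
    intro y hy z hz hyz
    have hy0 : 0 < y := ha.trans hy
    have hz0 : 0 < z := ha.trans hz
    rw [(hd y hy0).deriv, (hd z hz0).deriv, Real.rpow_def_of_pos hy0 (s - 1),
      Real.rpow_def_of_pos hz0 (s - 1), mul_left_comm, ← Real.exp_add, mul_left_comm,
      ← Real.exp_add]
    refine mul_le_mul_of_nonneg_left (Real.exp_le_exp.2 ?_) hs0.le
    have hys : 0 < y ^ s := Real.rpow_pos_of_pos hy0 s
    have hzs : 0 < z ^ s := Real.rpow_pos_of_pos hz0 s
    have hyzs : y ^ s ≤ z ^ s := Real.rpow_le_rpow hy0.le hyz hs0.le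
    have h1 : 1 ≤ s * y ^ s :=
      has.trans (mul_le_mul_of_nonneg_left (Real.rpow_le_rpow ha.le (le_of_lt hy) hs0.le) hs0.le)
    have hlog : s * (Real.log z - Real.log y) ≤ z ^ s / y ^ s - 1 := by
      have := Real.log_le_sub_one_of_pos (div_pos hzs hys)
      rw [Real.log_div hzs.ne' hys.ne', Real.log_rpow hz0, Real.log_rpow hy0] at this
      linarith
    have hll : Real.log y ≤ Real.log z := Real.log_le_log hy0 hyz
    have h2 : s * (Real.log z - Real.log y) * y ^ s ≤ z ^ s - y ^ s := by
      calc _ ≤ (z ^ s / y ^ s - 1) * y ^ s := mul_le_mul_of_nonneg_right hlog hys.le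
        _ = _ := by field_simp
    have h3 : Real.log z - Real.log y ≤ z ^ s - y ^ s := by nlinarith
    nlinarith

/-- A nonnegative real is dominated by a multiple of its stretched exponential. -/
lemma exists_le_mul_exp_rpow {s : ℝ} (hs0 : 0 < s) :
    ∃ c : ℝ, ∀ t : ℝ, 0 ≤ t → t ≤ c * Real.exp (t ^ s) := by
  obtain ⟨n, hn⟩ := exists_nat_ge (1 / s)
  refine ⟨n.factorial, fun t ht => ?_⟩
  have hf : (1 : ℝ) ≤ n.factorial := by exact_mod_cast n.factorial_pos
  have hts : 0 ≤ t ^ s := Real.rpow_nonneg ht s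
  rcases le_total t 1 with h | h
  · have : 1 ≤ Real.exp (t ^ s) := Real.one_le_exp hts
    nlinarith
  · have h1 : t ≤ (t ^ s) ^ n := by
      rw [← Real.rpow_natCast, ← Real.rpow_mul ht]
      refine Real.self_le_rpow_of_one_le h ?_
      rw [div_le_iff₀ hs0] at hn
      linarith
    have h2 := Real.pow_div_factorial_le_exp (t ^ s) hts n
    rw [div_le_iff₀ (by positivity)] at h2
    linarith

/-- Jensen's inequality for `y ↦ exp (y ^ s)` and nonnegative functions shifted by `a`, together
with finiteness of the mean. -/
lemma exp_rpow_lintegral_le {s a : ℝ} (hs0 : 0 < s) (ha : 0 < a) (has : 1 ≤ s * a ^ s)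
    {E : Type*} [MeasurableSpace E] (ν : Measure E) [IsProbabilityMeasure ν]
    {f : E → ℝ} (hf : Measurable f) (hf0 : ∀ x, 0 ≤ f x)
    (hfin : (∫⁻ x, ENNReal.ofReal (Real.exp ((f x + a) ^ s)) ∂ν) < ⊤) :
    (∫⁻ x, ENNReal.ofReal (f x) ∂ν) < ⊤ ∧
      ENNReal.ofReal (Real.exp (((∫⁻ x, ENNReal.ofReal (f x) ∂ν).toReal + a) ^ s)) ≤
        ∫⁻ x, ENNReal.ofReal (Real.exp ((f x + a) ^ s)) ∂ν := by
  have hgm : Measurable fun x => Real.exp ((f x + a) ^ s) := by fun_prop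
  have hgi : Integrable (fun x => Real.exp ((f x + a) ^ s)) ν :=
    (lintegral_ofReal_ne_top_iff_integrable hgm.aestronglyMeasurable
      (.of_forall fun x => (Real.exp_pos _).le)).1 hfin.ne
  obtain ⟨c, hc⟩ := exists_le_mul_exp_rpow hs0
  have hfi : Integrable f ν := by
    refine (hgi.const_mul c).mono' hf.aestronglyMeasurable (.of_forall fun x => ?_)
    rw [Real.norm_of_nonneg (hf0 x)]
    have := hc (f x + a) (by linarith [hf0 x])
    linarith
  refine ⟨hfi.lintegral_lt_top, ?_⟩
  rw [← integral_eq_lintegral_of_nonneg_ae (.of_forall hf0) hf.aestronglyMeasurable,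
    ← ofReal_integral_eq_lintegral_ofReal hgi (.of_forall fun x => (Real.exp_pos _).le)]
  refine ENNReal.ofReal_le_ofReal ?_
  have hJ := (convexOn_exp_rpow hs0 ha has).map_integral_le (μ := ν) (f := fun x => f x + a)
    (fun y hy => ((Real.continuousAt_rpow_const y s
      (Or.inl (ha.trans_le hy).ne')).rexp).continuousWithinAt)
    isClosed_Ici (.of_forall fun x => by simpa using hf0 x) (hfi.add (integrable_const a)) hgi
  simpa [integral_add hfi (integrable_const a)] using hJ

theorem stmt_5 (s : ℝ) (hs0 : 0 < s) (hs1 : s < 1) :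
    ∃ C : ℝ, 0 < C ∧
      ∀ (Ω : Type*) [MeasurableSpace Ω] (μ : Measure Ω) [IsProbabilityMeasure μ]
        (E : Type*) [MeasurableSpace E] (ν : Measure E) [IsProbabilityMeasure ν]
        (X : E → Ω → ℝ), Measurable (Function.uncurry X) → (∀ x ω, 0 ≤ X x ω) →
        (∀ x, (∫⁻ ω, ENNReal.ofReal (Real.exp ((max (X x ω) 0) ^ s)) ∂μ) ≤ 2) →
        (∀ᵐ ω ∂μ, (∫⁻ x, ENNReal.ofReal (X x ω) ∂ν) < ⊤) ∧
          (∫⁻ ω, ENNReal.ofReal (Real.exp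
            ((C⁻¹ * (∫⁻ x, ENNReal.ofReal (X x ω) ∂ν).toReal) ^ s)) ∂μ) ≤ 2 := by
  obtain ⟨a, ha, has⟩ : ∃ a : ℝ, 0 < a ∧ a ^ s = 1 / s :=
    ⟨(1 / s) ^ (1 / s), by positivity, by
      rw [← Real.rpow_mul (by positivity), one_div_mul_cancel hs0.ne', Real.rpow_one]⟩
  have hl2 : 0 < Real.log 2 := Real.log_pos one_lt_two
  have hs' : 0 < 1 / s := by positivity
  set L : ℝ := Real.log 2 + 1 / s with hL
  have hL0 : 0 < L := by positivity
  set p : ℝ := Real.log 2 / L with hp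
  have hp0 : 0 < p := by positivity
  have hp1 : p ≤ 1 := by rw [hp, div_le_one hL0]; linarith
  have hpL : p * L = Real.log 2 := div_mul_cancel₀ _ hL0.ne'
  have hexpL : Real.exp L = 2 * Real.exp (1 / s) := by
    rw [hL, Real.exp_add, Real.exp_log two_pos]
  refine ⟨(p ^ (1 / s))⁻¹, by positivity, ?_⟩
  intro Ω _ μ _ E _ ν _ X hX hX0 hXs
  have hXm : ∀ ω, Measurable fun x => X x ω := fun ω => hX.of_uncurry_right
  have hjm : Measurable (Function.uncurry fun ω x =>
      ENNReal.ofReal (Real.exp ((X x ω + a) ^ s))) := by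
    have : Measurable fun q : Ω × E => X q.2 q.1 := hX.comp measurable_swap
    simp only [Function.uncurry_def]
    fun_prop
  have hGm : Measurable fun ω => ∫⁻ x, ENNReal.ofReal (Real.exp ((X x ω + a) ^ s)) ∂ν :=
    hjm.lintegral_prod_right
  have hshift : ∀ x, ∫⁻ ω, ENNReal.ofReal (Real.exp ((X x ω + a) ^ s)) ∂μ ≤
      ENNReal.ofReal (Real.exp L) := by
    intro x
    calc ∫⁻ ω, ENNReal.ofReal (Real.exp ((X x ω + a) ^ s)) ∂μ
        ≤ ∫⁻ ω, ENNReal.ofReal (Real.exp (1 / s)) *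
            ENNReal.ofReal (Real.exp ((max (X x ω) 0) ^ s)) ∂μ := by
          refine lintegral_mono fun ω => ?_
          rw [← ENNReal.ofReal_mul (Real.exp_pos _).le, ← Real.exp_add, max_eq_left (hX0 x ω)]
          refine ENNReal.ofReal_le_ofReal (Real.exp_le_exp.2 ?_)
          have := Real.rpow_add_le_add_rpow (hX0 x ω) ha.le hs0.le hs1.le
          linarith
      _ = ENNReal.ofReal (Real.exp (1 / s)) *
            ∫⁻ ω, ENNReal.ofReal (Real.exp ((max (X x ω) 0) ^ s)) ∂μ :=
          lintegral_const_mul' _ _ ENNReal.ofReal_ne_top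
      _ ≤ ENNReal.ofReal (Real.exp (1 / s)) * 2 := by gcongr; exact hXs x
      _ = ENNReal.ofReal (Real.exp L) := by
          rw [hexpL, ENNReal.ofReal_mul two_pos.le, mul_comm, ENNReal.ofReal_ofNat]
  have hG : ∫⁻ ω, ∫⁻ x, ENNReal.ofReal (Real.exp ((X x ω + a) ^ s)) ∂ν ∂μ ≤
      ENNReal.ofReal (Real.exp L) := by
    rw [lintegral_lintegral_swap hjm.aemeasurable]
    calc _ ≤ ∫⁻ _, ENNReal.ofReal (Real.exp L) ∂ν := lintegral_mono hshift
      _ = _ := by simp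
  have hae : ∀ᵐ ω ∂μ, ∫⁻ x, ENNReal.ofReal (Real.exp ((X x ω + a) ^ s)) ∂ν < ⊤ :=
    ae_lt_top hGm (hG.trans_lt ENNReal.ofReal_lt_top).ne
  have hJ := hae.mono fun ω hω =>
    exp_rpow_lintegral_le hs0 ha (by rw [has, mul_one_div_cancel hs0.ne']) ν (hXm ω)
      (fun x => hX0 x ω) hω
  refine ⟨hJ.mono fun ω h => h.1, ?_⟩
  have hbound : ∀ᵐ ω ∂μ, ENNReal.ofReal (Real.exp
      (((p ^ (1 / s))⁻¹⁻¹ * (∫⁻ x, ENNReal.ofReal (X x ω) ∂ν).toReal) ^ s)) ≤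
      ENNReal.ofReal (2 * p * Real.exp (-L)) *
        (∫⁻ x, ENNReal.ofReal (Real.exp ((X x ω + a) ^ s)) ∂ν) +
        ENNReal.ofReal (2 * (1 - p)) := by
    filter_upwards [hJ] with ω hω
    refine le_trans ?_ (add_le_add_left (mul_le_mul_right hω.2 _) _)
    set Y : ℝ := (∫⁻ x, ENNReal.ofReal (X x ω) ∂ν).toReal
    have hY : 0 ≤ Y := ENNReal.toReal_nonneg
    rw [← ENNReal.ofReal_mul (by positivity),
      ← ENNReal.ofReal_add (by positivity) (by linarith)]
    refine ENNReal.ofReal_le_ofReal ?_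
    rw [inv_inv, Real.mul_rpow (by positivity) hY, ← Real.rpow_mul hp0.le,
      one_div_mul_cancel hs0.ne', Real.rpow_one]
    have hmono : Y ^ s ≤ (Y + a) ^ s := Real.rpow_le_rpow hY (by linarith) hs0.le
    have hconv := convexOn_exp.2 (Set.mem_univ (Y ^ s - L)) (Set.mem_univ 0) hp0.le
      (sub_nonneg.2 hp1) (by ring)
    simp only [smul_eq_mul, mul_zero, add_zero, Real.exp_zero, mul_one] at hconv
    calc Real.exp (p * Y ^ s) = 2 * Real.exp (p * (Y ^ s - L)) := by
          rw [mul_sub, hpL, Real.exp_sub, Real.exp_log two_pos]; ring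
      _ ≤ 2 * (p * Real.exp (Y ^ s - L) + (1 - p)) := by gcongr
      _ = 2 * p * Real.exp (-L) * Real.exp (Y ^ s) + 2 * (1 - p) := by
          rw [sub_eq_add_neg, Real.exp_add]; ring
      _ ≤ _ := by gcongr
  calc _ ≤ ∫⁻ ω, (ENNReal.ofReal (2 * p * Real.exp (-L)) *
        (∫⁻ x, ENNReal.ofReal (Real.exp ((X x ω + a) ^ s)) ∂ν) +
        ENNReal.ofReal (2 * (1 - p))) ∂μ := lintegral_mono_ae hbound
    _ = ENNReal.ofReal (2 * p * Real.exp (-L)) *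
        (∫⁻ ω, ∫⁻ x, ENNReal.ofReal (Real.exp ((X x ω + a) ^ s)) ∂ν ∂μ) +
        ENNReal.ofReal (2 * (1 - p)) := by
      rw [lintegral_add_right _ measurable_const,
        lintegral_const_mul' _ _ ENNReal.ofReal_ne_top]
      simp
    _ ≤ ENNReal.ofReal (2 * p * Real.exp (-L)) * ENNReal.ofReal (Real.exp L) +
        ENNReal.ofReal (2 * (1 - p)) := by gcongr
    _ = 2 := by
      rw [← ENNReal.ofReal_mul (by positivity),
        ← ENNReal.ofReal_add (by positivity) (by linarith), mul_assoc, ← Real.exp_add,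
        neg_add_cancel, Real.exp_zero, mul_one, ← ENNReal.ofReal_ofNat]
      congr 1
      ring
end

section
/- Let λ̄ ∈ (0, ∞) and s ∈ (1,2]. There exists a constant C(s, λ̄) < ∞ such that for every σ² > 0, 𝐜 > 0, λ₁ ∈ [0, λ̄] and θ ∈ (0, 1], the following holds: if X₁ and X₂ are real random variables on a common probability space with 𝔼[X₁] = 𝔼[X₂] = 0 satisfying X₁ = 𝒩(σ², 𝐜, λ₁) and X₂ = O_s(θ), then X₁ + X₂ = 𝒩(σ², 𝐜 + C √θ (1 + σ² + 𝐜), (1 − √θ) λ₁). -/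
open MeasureTheory

/-- `X = 𝒩(σ², c, λ₁)`: for every `λ ∈ ℝ` with `|λ| < λ₁`,
`|log 𝔼[exp(λ X)] − σ² λ² / 2| ≤ c λ²`, stated as the equivalent two-sided bound
`exp(σ²λ²/2 − cλ²) ≤ 𝔼[exp(λ X)] ≤ exp(σ²λ²/2 + cλ²)`. -/
def gaussBound {Ω : Type*} [MeasurableSpace Ω] (μ : Measure Ω) (σ2 c lam1 : ℝ)
    (X : Ω → ℝ) : Prop :=
  ∀ lam : ℝ, |lam| < lam1 →
    ENNReal.ofReal (Real.exp (σ2 * lam ^ 2 / 2 - c * lam ^ 2)) ≤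
        (∫⁻ ω, ENNReal.ofReal (Real.exp (lam * X ω)) ∂μ) ∧
      (∫⁻ ω, ENNReal.ofReal (Real.exp (lam * X ω)) ∂μ) ≤
        ENNReal.ofReal (Real.exp (σ2 * lam ^ 2 / 2 + c * lam ^ 2))

lemma exists_sq_mul_exp_le_exp_rpow (M : ℝ) (hM : 0 < M) {s : ℝ} (hs : 1 < s) :
    ∃ A : ℝ, 0 < A ∧ ∀ u : ℝ, 0 ≤ u → u ^ 2 * Real.exp (M * u) ≤ A * Real.exp (u ^ s) := by
  set R : ℝ := (M + 1) ^ (1 / (s - 1)) with hR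
  have hs' : 0 < s - 1 := by linarith
  have hR0 : 0 < R := Real.rpow_pos_of_pos (by linarith) _
  have hRs : R ^ (s - 1) = M + 1 := by
    rw [hR, ← Real.rpow_mul (by linarith), one_div_mul_cancel hs'.ne', Real.rpow_one]
  refine ⟨2 * Real.exp ((M + 1) * R), by positivity, fun u hu => ?_⟩
  have h1 : u ^ 2 ≤ 2 * Real.exp u := by
    have := Real.pow_div_factorial_le_exp u hu 2
    norm_num at this
    linarith
  have h2 : (M + 1) * u ≤ (M + 1) * R + u ^ s := by
    rcases le_total u R with h | h
    · have : (M + 1) * u ≤ (M + 1) * R := by gcongr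
      have := Real.rpow_nonneg hu s
      linarith
    · have hu0 : 0 < u := hR0.trans_le h
      have h3 : M + 1 ≤ u ^ (s - 1) := by
        rw [← hRs]
        exact Real.rpow_le_rpow hR0.le h hs'.le
      have h4 : u ^ s = u ^ (s - 1) * u := by
        rw [← Real.rpow_add_one hu0.ne']
        congr 1
        ring
      have : (M + 1) * u ≤ u ^ (s - 1) * u := by gcongr
      have : 0 < (M + 1) * R := by positivity
      linarith
  calc u ^ 2 * Real.exp (M * u) ≤ 2 * Real.exp u * Real.exp (M * u) := by gcongr
    _ = 2 * Real.exp ((M + 1) * u) := by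
      rw [mul_assoc, ← Real.exp_add]
      congr 2
      ring
    _ ≤ 2 * Real.exp ((M + 1) * R + u ^ s) := by gcongr
    _ = _ := by rw [Real.exp_add, mul_assoc]

lemma exp_le_one_add_add_sq_mul_exp_abs (x : ℝ) :
    Real.exp x ≤ 1 + x + x ^ 2 * Real.exp |x| := by
  have he : 1 ≤ Real.exp |x| := Real.one_le_exp (abs_nonneg x)
  have hx2 : x ^ 2 ≤ x ^ 2 * Real.exp |x| := le_mul_of_one_le_right (sq_nonneg x) he
  rcases le_total |x| 1 with h | h
  · have := (abs_le.1 (Real.abs_exp_sub_one_sub_id_le h)).2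
    linarith
  · have h1 : 1 ≤ x ^ 2 := by rw [← sq_abs]; nlinarith
    rcases le_total 0 x with h0 | h0
    · rw [abs_of_nonneg h0] at he ⊢
      nlinarith
    · have h3 : Real.exp x ≤ 1 := Real.exp_le_one_iff.2 h0
      rw [abs_of_nonpos h0] at h hx2 ⊢
      nlinarith

lemma lintegral_exp_rpow_abs_le {Ω : Type*} [MeasurableSpace Ω] {μ : Measure Ω} {s θ : ℝ}
    {X : Ω → ℝ} (hX : AEMeasurable X μ)
    (hpos : (∫⁻ ω, ENNReal.ofReal (Real.exp ((θ⁻¹ * max (X ω) 0) ^ s)) ∂μ) ≤ 2)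
    (hneg : (∫⁻ ω, ENNReal.ofReal (Real.exp ((θ⁻¹ * max (-X ω) 0) ^ s)) ∂μ) ≤ 2) :
    (∫⁻ ω, ENNReal.ofReal (Real.exp ((θ⁻¹ * |X ω|) ^ s)) ∂μ) ≤ 4 := by
  calc (∫⁻ ω, ENNReal.ofReal (Real.exp ((θ⁻¹ * |X ω|) ^ s)) ∂μ)
      ≤ ∫⁻ ω, (ENNReal.ofReal (Real.exp ((θ⁻¹ * max (X ω) 0) ^ s)) +
          ENNReal.ofReal (Real.exp ((θ⁻¹ * max (-X ω) 0) ^ s))) ∂μ := by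
        refine lintegral_mono fun ω => ?_
        rcases le_total 0 (X ω) with h | h
        · rw [abs_of_nonneg h, max_eq_left h]
          exact le_self_add
        · rw [abs_of_nonpos h, max_eq_left (neg_nonneg.2 h)]
          exact le_add_self
    _ = (∫⁻ ω, ENNReal.ofReal (Real.exp ((θ⁻¹ * max (X ω) 0) ^ s)) ∂μ) +
          ∫⁻ ω, ENNReal.ofReal (Real.exp ((θ⁻¹ * max (-X ω) 0) ^ s)) ∂μ :=
        lintegral_add_left' (by fun_prop) _
    _ ≤ 2 + 2 := add_le_add hpos hneg
    _ = 4 := by norm_num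

lemma lintegral_exp_mul_le_of_lintegral_exp_rpow_le {Ω : Type*} [MeasurableSpace Ω]
    {μ : Measure Ω} [IsProbabilityMeasure μ] {s θ M A : ℝ} (hθ : 0 < θ) (hA : 0 < A)
    (hAs : ∀ u : ℝ, 0 ≤ u → u ^ 2 * Real.exp (M * u) ≤ A * Real.exp (u ^ s))
    {X : Ω → ℝ} (hX : Integrable X μ) (hX0 : (∫ ω, X ω ∂μ) = 0)
    (hexp : (∫⁻ ω, ENNReal.ofReal (Real.exp ((θ⁻¹ * |X ω|) ^ s)) ∂μ) ≤ 4)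
    {l : ℝ} (hl : |l| * θ ≤ M) :
    (∫⁻ ω, ENNReal.ofReal (Real.exp (l * X ω)) ∂μ) ≤
      ENNReal.ofReal (Real.exp (4 * A * (l * θ) ^ 2)) := by
  have hXm := hX.aemeasurable
  have hgi : Integrable (fun ω => Real.exp ((θ⁻¹ * |X ω|) ^ s)) μ := by
    refine ⟨AEMeasurable.aestronglyMeasurable (by fun_prop), ?_⟩
    rw [hasFiniteIntegral_iff_ofReal (Filter.Eventually.of_forall fun _ => (Real.exp_pos _).le)]
    exact hexp.trans_lt (by norm_num)
  have hg4 : (∫ ω, Real.exp ((θ⁻¹ * |X ω|) ^ s) ∂μ) ≤ 4 := by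
    rw [integral_eq_lintegral_of_nonneg_ae
      (Filter.Eventually.of_forall fun _ => (Real.exp_pos _).le) hgi.aestronglyMeasurable]
    exact ENNReal.toReal_mono (by norm_num) hexp
  have hpt : ∀ ω, Real.exp (l * X ω) ≤
      1 + l * X ω + (l * θ) ^ 2 * A * Real.exp ((θ⁻¹ * |X ω|) ^ s) := by
    intro ω
    have hu : 0 ≤ θ⁻¹ * |X ω| := by positivity
    have h1 := exp_le_one_add_add_sq_mul_exp_abs (l * X ω)
    have h2 := hAs _ hu
    have h3 : |l * X ω| ≤ M * (θ⁻¹ * |X ω|) := by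
      calc |l * X ω| = |l| * θ * (θ⁻¹ * |X ω|) := by rw [abs_mul]; field_simp
        _ ≤ _ := by gcongr
    have h4 : (l * X ω) ^ 2 = (l * θ) ^ 2 * (θ⁻¹ * |X ω|) ^ 2 := by
      rw [mul_pow θ⁻¹, sq_abs]
      field_simp
    calc Real.exp (l * X ω) ≤ 1 + l * X ω + (l * X ω) ^ 2 * Real.exp |l * X ω| := h1
      _ ≤ 1 + l * X ω + (l * X ω) ^ 2 * Real.exp (M * (θ⁻¹ * |X ω|)) := by gcongr
      _ = 1 + l * X ω + (l * θ) ^ 2 *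
          ((θ⁻¹ * |X ω|) ^ 2 * Real.exp (M * (θ⁻¹ * |X ω|))) := by rw [h4]; ring
      _ ≤ 1 + l * X ω + (l * θ) ^ 2 * (A * Real.exp ((θ⁻¹ * |X ω|) ^ s)) := by gcongr
      _ = _ := by ring
  have hlin : Integrable (fun ω => 1 + l * X ω) μ :=
    (integrable_const 1).add (hX.const_mul l)
  have hsq := hgi.const_mul ((l * θ) ^ 2 * A)
  have hint : (∫ ω, (1 + l * X ω + (l * θ) ^ 2 * A * Real.exp ((θ⁻¹ * |X ω|) ^ s)) ∂μ) =
      1 + (l * θ) ^ 2 * A * ∫ ω, Real.exp ((θ⁻¹ * |X ω|) ^ s) ∂μ := by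
    rw [integral_add hlin hsq, integral_add (integrable_const 1) (hX.const_mul l),
      integral_const_mul, integral_const_mul, hX0]
    simp
  calc (∫⁻ ω, ENNReal.ofReal (Real.exp (l * X ω)) ∂μ)
      ≤ ∫⁻ ω, ENNReal.ofReal
          (1 + l * X ω + (l * θ) ^ 2 * A * Real.exp ((θ⁻¹ * |X ω|) ^ s)) ∂μ :=
        lintegral_mono fun ω => ENNReal.ofReal_le_ofReal (hpt ω)
    _ = ENNReal.ofReal (1 + (l * θ) ^ 2 * A * ∫ ω, Real.exp ((θ⁻¹ * |X ω|) ^ s) ∂μ) := by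
        rw [← hint]
        exact (ofReal_integral_eq_lintegral_ofReal (hlin.add hsq)
          (Filter.Eventually.of_forall fun ω => (Real.exp_pos _).le.trans (hpt ω))).symm
    _ ≤ _ := by
        refine ENNReal.ofReal_le_ofReal ?_
        have h1 : (l * θ) ^ 2 * A * (∫ ω, Real.exp ((θ⁻¹ * |X ω|) ^ s) ∂μ) ≤
            (l * θ) ^ 2 * A * 4 := by gcongr
        have h2 := Real.add_one_le_exp (4 * A * (l * θ) ^ 2)
        linarith

lemma ofReal_exp_rpow (x t : ℝ) (ht : 0 ≤ t) :
    ENNReal.ofReal (Real.exp x) ^ t = ENNReal.ofReal (Real.exp (t * x)) := by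
  rw [ENNReal.ofReal_rpow_of_nonneg (Real.exp_pos _).le ht, ← Real.exp_mul, mul_comm]

lemma lintegral_exp_add_le {Ω : Type*} [MeasurableSpace Ω] {μ : Measure Ω} {t : ℝ}
    (ht0 : 0 < t) (ht1 : t < 1) {f g : Ω → ℝ} (hf : AEMeasurable f μ) (hg : AEMeasurable g μ) :
    (∫⁻ ω, ENNReal.ofReal (Real.exp ((1 - t) * f ω + t * g ω)) ∂μ) ≤
      (∫⁻ ω, ENNReal.ofReal (Real.exp (f ω)) ∂μ) ^ (1 - t) *
        (∫⁻ ω, ENNReal.ofReal (Real.exp (g ω)) ∂μ) ^ t := by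
  have h := ENNReal.lintegral_mul_norm_pow_le (μ := μ)
    (f := fun ω => ENNReal.ofReal (Real.exp (f ω)))
    (g := fun ω => ENNReal.ofReal (Real.exp (g ω))) (by fun_prop) (by fun_prop)
    (sub_nonneg.2 ht1.le) ht0.le (sub_add_cancel 1 t)
  refine le_trans (le_of_eq (lintegral_congr fun ω => ?_)) h
  rw [ofReal_exp_rpow _ _ (sub_nonneg.2 ht1.le), ofReal_exp_rpow _ _ ht0.le,
    ← ENNReal.ofReal_mul (Real.exp_pos _).le, ← Real.exp_add]

/-- Let `λ̄ ∈ (0,∞)` and `s ∈ (1,2]`. There exists `C(s, λ̄) < ∞` such that for every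
`σ² > 0`, `c > 0`, `λ₁ ∈ [0, λ̄]` and `θ ∈ (0,1]`: if `X₁, X₂` are centered real random
variables on a common probability space with `X₁ = 𝒩(σ², c, λ₁)` and `X₂ = O_s(θ)`
(i.e. `𝔼[exp((θ⁻¹ max(±X₂,0))^s)] ≤ 2`), then
`X₁ + X₂ = 𝒩(σ², c + C √θ (1 + σ² + c), (1 − √θ) λ₁)`. -/
theorem stmt_13 (lamBar : ℝ) (hlamBar : 0 < lamBar) (s : ℝ) (hs1 : 1 < s) (hs2 : s ≤ 2) :
    ∃ C : ℝ, 0 < C ∧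
      ∀ (Ω : Type*) [MeasurableSpace Ω] (μ : Measure Ω) [IsProbabilityMeasure μ]
        (σ2 c lam1 θ : ℝ), 0 < σ2 → 0 < c → 0 ≤ lam1 → lam1 ≤ lamBar → 0 < θ → θ ≤ 1 →
        ∀ X₁ X₂ : Ω → ℝ,
          Integrable X₁ μ → (∫ ω, X₁ ω ∂μ) = 0 →
          Integrable X₂ μ → (∫ ω, X₂ ω ∂μ) = 0 →
          gaussBound μ σ2 c lam1 X₁ →
          ((∫⁻ ω, ENNReal.ofReal (Real.exp ((θ⁻¹ * max (X₂ ω) 0) ^ s)) ∂μ) ≤ 2 ∧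
            (∫⁻ ω, ENNReal.ofReal (Real.exp ((θ⁻¹ * max (-X₂ ω) 0) ^ s)) ∂μ) ≤ 2) →
          gaussBound μ σ2 (c + C * Real.sqrt θ * (1 + σ2 + c))
            ((1 - Real.sqrt θ) * lam1) (fun ω => X₁ ω + X₂ ω) := by
  obtain ⟨A, hA, hAs⟩ := exists_sq_mul_exp_le_exp_rpow (2 * lamBar) (by linarith) hs1
  refine ⟨2 + 8 * A, by positivity, ?_⟩
  intro Ω _ μ _ σ2 c lam1 θ hσ hc hl0 hl1 hθ hθ1 X₁ X₂ hX₁ _ hX₂ hX₂0 hgauss hO lam hlam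
  have hX₁m := hX₁.aemeasurable
  have hX₂m := hX₂.aemeasurable
  set r := Real.sqrt θ with hr
  have hr0 : 0 < r := Real.sqrt_pos.2 hθ
  have hr1 : r ≤ 1 := by rw [hr]; exact Real.sqrt_le_one.2 hθ1
  have hrθ : θ = r * r := (Real.mul_self_sqrt hθ.le).symm
  obtain ⟨t, ht0, ht2, htr, hrt⟩ : ∃ t : ℝ, 0 < t ∧ t ≤ 1 / 2 ∧ t ≤ r ∧ r ≤ 2 * t := by
    rcases le_total r (1 / 2) with h | h
    · exact ⟨r, hr0, h, le_rfl, by linarith⟩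
    · exact ⟨1 / 2, by norm_num, le_rfl, h, by linarith⟩
  have ht1 : 0 < 1 - t := by linarith
  have hθt : θ / t ≤ 2 * r := by
    rw [div_le_iff₀ ht0, hrθ]
    nlinarith
  have hlam' : |lam| < (1 - t) * lam1 := hlam.trans_le (by gcongr)
  have hlamlt : |lam| < lam1 := hlam'.trans_le (by nlinarith)
  have hX₂exp : ∀ l : ℝ, |l| ≤ |lam| / t →
      (∫⁻ ω, ENNReal.ofReal (Real.exp (l * X₂ ω)) ∂μ) ^ t ≤
        ENNReal.ofReal (Real.exp (8 * A * r * (|l| * t) * |lam|)) := by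
    intro l hl
    have hlt : |l| * t ≤ |lam| := (le_div_iff₀ ht0).1 hl
    have hlθ : |l| * θ ≤ 2 * r * |lam| :=
      calc |l| * θ ≤ |lam| / t * θ := by gcongr
        _ = θ / t * |lam| := by ring
        _ ≤ _ := by gcongr
    have hlM : |l| * θ ≤ 2 * lamBar :=
      hlθ.trans (by nlinarith [abs_nonneg lam])
    refine (ENNReal.rpow_le_rpow (lintegral_exp_mul_le_of_lintegral_exp_rpow_le hθ hA hAs
      hX₂ hX₂0 (lintegral_exp_rpow_abs_le hX₂m hO.1 hO.2) hlM) ht0.le).trans ?_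
    rw [ofReal_exp_rpow _ _ ht0.le]
    refine ENNReal.ofReal_le_ofReal (Real.exp_le_exp.2 ?_)
    have e : t * (4 * A * (l * θ) ^ 2) = 4 * A * θ * (|l| * t) * (|l| * θ) := by
      rw [mul_pow, ← sq_abs l]; ring
    rw [e]
    calc 4 * A * θ * (|l| * t) * (|l| * θ) ≤ 4 * A * 1 * (|l| * t) * (2 * r * |lam|) := by gcongr
      _ = _ := by ring
  have hlamsq : |lam| * |lam| = lam ^ 2 := by rw [← sq, sq_abs]
  have hlsq : 0 ≤ lam ^ 2 := sq_nonneg lam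
  constructor
  · have hh := lintegral_exp_add_le (μ := μ) ht0 (by linarith)
      (f := fun ω => lam * (X₁ ω + X₂ ω)) (g := fun ω => -((1 - t) * lam / t) * X₂ ω)
      (by fun_prop) (by fun_prop)
    have e : ∀ ω, (1 - t) * (lam * (X₁ ω + X₂ ω)) + t * (-((1 - t) * lam / t) * X₂ ω) =
        (1 - t) * lam * X₁ ω := by
      intro ω
      field_simp
      ring
    simp only [e] at hh
    have habs : |-((1 - t) * lam / t)| = (1 - t) * |lam| / t := by
      rw [abs_neg, abs_div, abs_mul, abs_of_pos ht1, abs_of_pos ht0]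
    have h2 := hX₂exp (-((1 - t) * lam / t)) (by
      rw [habs]
      gcongr
      nlinarith [abs_nonneg lam])
    rw [habs, div_mul_cancel₀ _ ht0.ne'] at h2
    have h1 := (hgauss ((1 - t) * lam) (by
      rw [abs_mul, abs_of_pos ht1]; nlinarith [abs_nonneg lam])).1
    have h3 := (h1.trans hh).trans (mul_le_mul_right h2 _)
    rw [← ENNReal.rpow_le_rpow_iff ht1, ofReal_exp_rpow _ _ ht1.le]
    rw [← ENNReal.div_le_iff (by positivity) ENNReal.ofReal_ne_top,
      ← ENNReal.ofReal_div_of_pos (Real.exp_pos _), ← Real.exp_sub] at h3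
    refine (ENNReal.ofReal_le_ofReal (Real.exp_le_exp.2 ?_)).trans h3
    have e2 : 8 * A * r * ((1 - t) * |lam|) * |lam| = (1 - t) * (8 * A * r * lam ^ 2) := by
      rw [← hlamsq]; ring
    rw [e2]
    have e3 : σ2 * ((1 - t) * lam) ^ 2 / 2 - c * ((1 - t) * lam) ^ 2 -
        (1 - t) * (8 * A * r * lam ^ 2) =
        (1 - t) * (((1 - t) * (σ2 / 2 - c) - 8 * A * r) * lam ^ 2) := by ring
    rw [e3]
    refine mul_le_mul_of_nonneg_left ?_ ht1.le
    have e4 : σ2 * lam ^ 2 / 2 - (c + (2 + 8 * A) * r * (1 + σ2 + c)) * lam ^ 2 =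
        (σ2 / 2 - (c + (2 + 8 * A) * r * (1 + σ2 + c))) * lam ^ 2 := by ring
    rw [e4]
    refine mul_le_mul_of_nonneg_right ?_ hlsq
    have p1 : t * σ2 ≤ r * σ2 := by gcongr
    have p2 : 0 ≤ A * r * (σ2 + c) := by positivity
    have p3 : 0 ≤ t * c := by positivity
    have p4 : 0 ≤ r * c := by positivity
    have p5 : 0 ≤ r * σ2 := by positivity
    linarith
  · have hh := lintegral_exp_add_le (μ := μ) ht0 (by linarith)
      (f := fun ω => lam / (1 - t) * X₁ ω) (g := fun ω => lam / t * X₂ ω)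
      (by fun_prop) (by fun_prop)
    have e : ∀ ω, (1 - t) * (lam / (1 - t) * X₁ ω) + t * (lam / t * X₂ ω) =
        lam * (X₁ ω + X₂ ω) := by
      intro ω
      field_simp
    simp only [e] at hh
    have habs : |lam / t| = |lam| / t := by rw [abs_div, abs_of_pos ht0]
    have h2 := hX₂exp (lam / t) habs.le
    rw [habs, div_mul_cancel₀ _ ht0.ne'] at h2
    have h1 := (hgauss (lam / (1 - t)) (by
      rw [abs_div, abs_of_pos ht1, div_lt_iff₀ ht1]; linarith)).2
    refine (hh.trans (mul_le_mul' (ENNReal.rpow_le_rpow h1 ht1.le) h2)).trans ?_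
    rw [ofReal_exp_rpow _ _ ht1.le, ← ENNReal.ofReal_mul (Real.exp_pos _).le, ← Real.exp_add]
    refine ENNReal.ofReal_le_ofReal (Real.exp_le_exp.2 ?_)
    have e3 : (1 - t) * (σ2 * (lam / (1 - t)) ^ 2 / 2 + c * (lam / (1 - t)) ^ 2) +
        8 * A * r * |lam| * |lam| = ((σ2 / 2 + c) / (1 - t) + 8 * A * r) * lam ^ 2 := by
      rw [mul_assoc _ |lam|, hlamsq]
      field_simp
    have e4 : σ2 * lam ^ 2 / 2 + (c + (2 + 8 * A) * r * (1 + σ2 + c)) * lam ^ 2 =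
        (σ2 / 2 + (c + (2 + 8 * A) * r * (1 + σ2 + c))) * lam ^ 2 := by ring
    rw [e3, e4]
    refine mul_le_mul_of_nonneg_right ?_ hlsq
    have p0 : (σ2 / 2 + c) / (1 - t) ≤ (σ2 / 2 + c) * (1 + 2 * t) := by
      rw [div_le_iff₀ ht1, mul_assoc]
      refine le_mul_of_one_le_right (by positivity) ?_
      nlinarith
    have p1 : t * σ2 ≤ r * σ2 := by gcongr
    have p2 : 0 ≤ A * r * (σ2 + c) := by positivity
    have p3 : t * c ≤ r * c := by gcongr
    have p5 : 0 ≤ r * σ2 := by positivity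
    linarith
end
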